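/- Characterization of Â* = Â^N: with the Hartwig–Spindelböck decomposition data as in the context and Â^N := Û · fromBlocks(K*Σ₁⁻¹, 0, L*Σ₁⁻¹, 0) · Û* (the NDMPI of Â), one has Â* = Â^N if and only if Σ₂d·M_s = 0, Σ₂d·N_s = 0, and Σ₁ = I, where M_s and N_s denote the entrywise standard parts of M and N and Σ₂d denotes the dual part of Σ₂. -/

import Mathlib

open Matrix

/-- The dual complex numbers `𝔻ℂ := ℂ[ε]`, the trivial square-zero extension of `ℂ` by `ℂ`. -/
abbrev DC := TrivSqZeroExt ℂ ℂ

/-- Star on dual complex numbers: `(a + b·ε)* = conj a + conj b · ε`. -/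
instance : Star DC :=
  ⟨fun x => ((starRingEnd ℂ) x.fst, (starRingEnd ℂ) x.snd)⟩

/-- A positive appreciable real dual number: the standard part is a positive real and
the dual part is real. -/
def PosAppreciable (x : DC) : Prop :=
  (∃ a : ℝ, 0 < a ∧ x.fst = (a : ℂ)) ∧ (∃ b : ℝ, x.snd = (b : ℂ))

/-- A nonnegative infinitesimal real dual number: the standard part is `0` and
the dual part is a nonnegative real. -/
def NonnegInfinitesimal (x : DC) : Prop :=
  x.fst = 0 ∧ ∃ b : ℝ, 0 ≤ b ∧ x.snd = (b : ℂ)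

/-- The standard part of a dual complex matrix. -/
def stdPart {m n : Type*} (X : Matrix m n DC) : Matrix m n ℂ :=
  X.map TrivSqZeroExt.fst

/-- The dual part of a dual complex matrix. -/
def dualPart {m n : Type*} (X : Matrix m n DC) : Matrix m n ℂ :=
  X.map TrivSqZeroExt.snd

open TrivSqZeroExt in
/-- The star on the dual complex numbers makes them a star ring. -/
abbrev DC.starRing : StarRing DC where
  star_involutive x := by
    apply TrivSqZeroExt.ext
    · exact Complex.conj_conj x.fst
    · exact Complex.conj_conj x.snd
  star_mul x y := by
    apply TrivSqZeroExt.ext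
    · change (starRingEnd ℂ) (x * y).fst = (starRingEnd ℂ) y.fst * (starRingEnd ℂ) x.fst
      rw [fst_mul, map_mul, mul_comm]
    · change (starRingEnd ℂ) (x * y).snd = (starRingEnd ℂ) y.fst * (starRingEnd ℂ) x.snd +
        (starRingEnd ℂ) y.snd * (starRingEnd ℂ) x.fst
      rw [snd_mul, map_add]
      simp only [smul_eq_mul, op_smul_eq_mul, map_mul]
      ring
  star_add x y := by
    apply TrivSqZeroExt.ext
    · exact map_add (starRingEnd ℂ) x.fst y.fst
    · exact map_add (starRingEnd ℂ) x.snd y.snd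

section

attribute [local instance] DC.starRing

theorem PosAppreciable.star_eq {x : DC} (hx : PosAppreciable x) : star x = x := by
  obtain ⟨⟨a, -, ha⟩, b, hb⟩ := hx
  apply TrivSqZeroExt.ext
  · change (starRingEnd ℂ) x.fst = x.fst
    rw [ha, Complex.conj_ofReal]
  · change (starRingEnd ℂ) x.snd = x.snd
    rw [hb, Complex.conj_ofReal]

theorem PosAppreciable.isUnit {x : DC} (hx : PosAppreciable x) : IsUnit x := by
  obtain ⟨⟨a, ha, hxa⟩, -⟩ := hx
  rw [TrivSqZeroExt.isUnit_iff_isUnit_fst, hxa, isUnit_iff_ne_zero]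
  exact_mod_cast ha.ne'

/-- The only positive appreciable square root of `1` is `1`. -/
theorem PosAppreciable.eq_one_of_mul_self {x : DC} (hx : PosAppreciable x) (h : x * x = 1) :
    x = 1 := by
  obtain ⟨⟨a, ha, hxa⟩, -⟩ := hx
  have h₁ : x.fst = 1 := by
    have h₂ := congrArg TrivSqZeroExt.fst h
    rw [TrivSqZeroExt.fst_mul, TrivSqZeroExt.fst_one, hxa] at h₂
    have h₃ : a * a = 1 := by exact_mod_cast h₂
    have h₄ : a = 1 := by nlinarith
    rw [hxa, h₄, Complex.ofReal_one]
  apply TrivSqZeroExt.ext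
  · rw [h₁, TrivSqZeroExt.fst_one]
  · have h₂ := congrArg TrivSqZeroExt.snd h
    rw [TrivSqZeroExt.snd_mul, TrivSqZeroExt.snd_one, h₁] at h₂
    simp only [one_smul, MulOpposite.op_one] at h₂
    rw [TrivSqZeroExt.snd_one]
    exact self_eq_neg.mp (eq_neg_of_add_eq_zero_left h₂)

theorem NonnegInfinitesimal.star_eq {x : DC} (hx : NonnegInfinitesimal x) : star x = x := by
  obtain ⟨ha, b, -, hb⟩ := hx
  apply TrivSqZeroExt.ext
  · change (starRingEnd ℂ) x.fst = x.fst
    rw [ha, map_zero]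
  · change (starRingEnd ℂ) x.snd = x.snd
    rw [hb, Complex.conj_ofReal]

/-- A product with an infinitesimal diagonal matrix only sees the standard part. -/
theorem diagonal_mul_eq_zero_iff_dualPart {m n : Type*} [Fintype m] [DecidableEq m]
    {d : m → DC} (hd : ∀ i, (d i).fst = 0) (X : Matrix m n DC) :
    Matrix.diagonal d * X = 0 ↔ dualPart (Matrix.diagonal d) * stdPart X = 0 := by
  have h : dualPart (Matrix.diagonal d) = Matrix.diagonal fun i => (d i).snd :=
    Matrix.diagonal_map TrivSqZeroExt.snd_zero
  rw [h, ← Matrix.ext_iff, ← Matrix.ext_iff]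
  refine forall₂_congr fun i j => ?_
  rw [Matrix.diagonal_mul, Matrix.diagonal_mul, TrivSqZeroExt.ext_iff]
  simp [hd, stdPart, mul_comm]

theorem conj_unitary_inj {n R : Type*} [Fintype n] [DecidableEq n] [CommRing R] [StarRing R]
    {U : Matrix n n R} (hU : Uᴴ * U = 1) {X Y : Matrix n n R} :
    U * X * Uᴴ = U * Y * Uᴴ ↔ X = Y := by
  refine ⟨fun h => ?_, fun h => by rw [h]⟩
  have key : ∀ Z : Matrix n n R, Uᴴ * (U * Z * Uᴴ) * U = Z := fun Z => by
    rw [Matrix.mul_assoc U, ← Matrix.mul_assoc, hU, Matrix.one_mul, Matrix.mul_assoc, hU,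
      Matrix.mul_one]
  rw [← key X, h, key Y]

theorem conjTranspose_mul_eq_zero_iff_of_isHermitian {m n R : Type*} [Fintype m] [CommRing R]
    [StarRing R] {S : Matrix m m R} (hS : Sᴴ = S) (X : Matrix m n R) :
    Xᴴ * S = 0 ↔ S * X = 0 := by
  rw [← Matrix.conjTranspose_eq_zero (M := S * X), Matrix.conjTranspose_mul, hS]

/-- If `[K L]` has orthonormal rows, right multiplication of `[K L]ᴴ` is injective. -/
theorem conjTranspose_mul_inj_of_row_orthonormal {m n R : Type*} [Fintype m] [DecidableEq m]
    [Fintype n] [CommRing R] [StarRing R] {K : Matrix m m R} {L : Matrix m n R}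
    (h : K * Kᴴ + L * Lᴴ = 1) {X Y : Matrix m m R} :
    (Kᴴ * X = Kᴴ * Y ∧ Lᴴ * X = Lᴴ * Y) ↔ X = Y := by
  refine ⟨fun ⟨hK, hL⟩ => ?_, fun h => by simp [h]⟩
  rw [← Matrix.one_mul X, ← Matrix.one_mul Y, ← h, Matrix.add_mul, Matrix.add_mul]
  simp only [Matrix.mul_assoc, hK, hL]

theorem diagonal_eq_inv_iff_of_posAppreciable {m : Type*} [Fintype m] [DecidableEq m]
    {d : m → DC} (hd : ∀ i, PosAppreciable (d i)) :
    Matrix.diagonal d = (Matrix.diagonal d)⁻¹ ↔ Matrix.diagonal d = 1 := by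
  refine ⟨fun h => ?_, fun h => by rw [h, inv_one]⟩
  have hu : IsUnit (Matrix.diagonal d).det := by
    rw [Matrix.det_diagonal]
    exact IsUnit.prod_univ_iff.mpr fun i => (hd i).isUnit
  have hsq : Matrix.diagonal d * Matrix.diagonal d = 1 := by
    nth_rewrite 2 [h]
    exact Matrix.mul_nonsing_inv _ hu
  rw [Matrix.diagonal_mul_diagonal, ← Matrix.diagonal_one] at hsq
  rw [← Matrix.diagonal_one]
  exact congrArg Matrix.diagonal (funext fun i =>
    (hd i).eq_one_of_mul_self (congrFun (Matrix.diagonal_injective hsq) i))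

end

/-- Characterization of `Â* = Â^N`. -/
theorem conjTranspose_eq_ndmpi_iff
    {r s : ℕ}
    -- `Û`, a unitary matrix
    (U : Matrix (Fin r ⊕ Fin s) (Fin r ⊕ Fin s) DC)
    (hU₁ : U * Uᴴ = 1) (hU₂ : Uᴴ * U = 1)
    -- the blocks `K, L, M, N` forming a unitary block matrix
    (K : Matrix (Fin r) (Fin r) DC) (L : Matrix (Fin r) (Fin s) DC)
    (M : Matrix (Fin s) (Fin r) DC) (N : Matrix (Fin s) (Fin s) DC)
    (hW₁ : fromBlocks K L M N * (fromBlocks K L M N)ᴴ = 1)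
    (hW₂ : (fromBlocks K L M N)ᴴ * fromBlocks K L M N = 1)
    -- `Σ₁` diagonal with positive appreciable real dual diagonal entries
    (S₁ : Matrix (Fin r) (Fin r) DC) (d₁ : Fin r → DC)
    (hS₁ : S₁ = Matrix.diagonal d₁) (hd₁ : ∀ i, PosAppreciable (d₁ i))
    -- `Σ₂` diagonal with nonnegative infinitesimal real dual diagonal entries
    (S₂ : Matrix (Fin s) (Fin s) DC) (d₂ : Fin s → DC)
    (hS₂ : S₂ = Matrix.diagonal d₂) (hd₂ : ∀ i, NonnegInfinitesimal (d₂ i))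
    -- the Hartwig–Spindelböck decomposition of `Â`
    (A : Matrix (Fin r ⊕ Fin s) (Fin r ⊕ Fin s) DC)
    (hA : A = U * fromBlocks (S₁ * K) (S₁ * L) (S₂ * M) (S₂ * N) * Uᴴ)
    -- `Â^N`, the NDMPI of `Â`
    (AN : Matrix (Fin r ⊕ Fin s) (Fin r ⊕ Fin s) DC)
    (hAN : AN = U * fromBlocks (Kᴴ * S₁⁻¹) 0 (Lᴴ * S₁⁻¹) 0 * Uᴴ) :
    Aᴴ = AN ↔
      dualPart S₂ * stdPart M = 0 ∧ dualPart S₂ * stdPart N = 0 ∧ S₁ = 1 := by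
  let _ := DC.starRing
  have hS₁' : S₁ᴴ = S₁ := by
    rw [hS₁, Matrix.diagonal_conjTranspose]
    exact congrArg Matrix.diagonal (funext fun i => (hd₁ i).star_eq)
  have hS₂' : S₂ᴴ = S₂ := by
    rw [hS₂, Matrix.diagonal_conjTranspose]
    exact congrArg Matrix.diagonal (funext fun i => (hd₂ i).star_eq)
  have hKL : K * Kᴴ + L * Lᴴ = 1 := by
    rw [Matrix.fromBlocks_conjTranspose, Matrix.fromBlocks_multiply, ← Matrix.fromBlocks_one,
      Matrix.fromBlocks_inj] at hW₁
    exact hW₁.1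
  have hA' : Aᴴ = U * fromBlocks (Kᴴ * S₁) (Mᴴ * S₂) (Lᴴ * S₁) (Nᴴ * S₂) * Uᴴ := by
    rw [hA, Matrix.conjTranspose_mul, Matrix.conjTranspose_mul, Matrix.conjTranspose_conjTranspose,
      Matrix.fromBlocks_conjTranspose, Matrix.conjTranspose_mul, Matrix.conjTranspose_mul,
      Matrix.conjTranspose_mul, Matrix.conjTranspose_mul, hS₁', hS₂', ← Matrix.mul_assoc]
  have hinv : S₁ = S₁⁻¹ ↔ S₁ = 1 := by
    rw [hS₁]
    exact diagonal_eq_inv_iff_of_posAppreciable hd₁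
  have hdual : ∀ {n : Type} (X : Matrix (Fin s) n DC),
      S₂ * X = 0 ↔ dualPart S₂ * stdPart X = 0 := fun X => by
    rw [hS₂]
    exact diagonal_mul_eq_zero_iff_dualPart (fun i => (hd₂ i).1) X
  have hadj : ∀ {n : Type} (X : Matrix (Fin s) n DC), Xᴴ * S₂ = 0 ↔ S₂ * X = 0 := fun X =>
    conjTranspose_mul_eq_zero_iff_of_isHermitian (R := DC) hS₂' X
  rw [hA', hAN, conj_unitary_inj hU₂, Matrix.fromBlocks_inj,
    hadj, hadj, hdual, hdual, ← hinv,
    ← conjTranspose_mul_inj_of_row_orthonormal hKL (X := S₁)]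
  tauto
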